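/- arXiv:2101.11300 — 4 statements merged into one kernel-verified Lean document; each statement's English description precedes it below -/
import Mathlib

section
/- Let V be a finite vertex set with capacities c, let S and T be disjoint subsets of V, and let g be a flow from S to T that is acyclic, i.e., there is no directed cycle v_0, v_1, …, v_m = v_0 with m ≥ 1 and g(v_i, v_{i+1}) > 0 for every i < m. Then for every vertex v, Σ_u g(u,v) ≤ |g|. -/
open Finset

/-- The excess of a vertex `v` under `g`: total flow into `v` minus total flow out of `v`. -/
def ex {V : Type*} [Fintype V] (g : V → V → ℝ) (v : V) : ℝ :=
  (∑ u, g u v) - (∑ u, g v u)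

lemma path_of_transGen {V : Type*} (r : V → V → Prop) {a b : V} (h : Relation.TransGen r a b) :
    ∃ (m : ℕ) (p : ℕ → V), 1 ≤ m ∧ p 0 = a ∧ p m = b ∧ ∀ i < m, r (p i) (p (i + 1)) := by
  induction h using Relation.TransGen.head_induction_on with
  | single h =>
    rename_i a
    refine ⟨1, fun i => Nat.casesOn i a (fun _ => b), le_rfl, rfl, rfl, ?_⟩
    intro i hi
    obtain rfl : i = 0 := by omega
    exact h
  | head h _ ih =>
    rename_i a c _
    obtain ⟨m, p, hm, h0, h1, hp⟩ := ih
    refine ⟨m + 1, fun i => Nat.casesOn i a p, by omega, rfl, h1, ?_⟩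
    intro i hi
    cases i with
    | zero => simpa [h0] using h
    | succ k => exact hp k (by omega)

/-- In an acyclic flow `g` from `S` to `T`, the flow into any vertex is at most the
value `|g|` of the flow. -/
theorem stmt7 {V : Type*} [Fintype V] [DecidableEq V] (c g : V → V → ℝ)
    (S T : Finset V) (hST : Disjoint S T)
    (hc : ∀ u v, 0 ≤ c u v)
    (hg : ∀ u v, 0 ≤ g u v ∧ g u v ≤ c u v)
    (hcons : ∀ v, v ∉ S ∪ T → ex g v = 0)
    (hS : ∀ u ∈ S, ex g u ≤ 0)
    (hT : ∀ w ∈ T, 0 ≤ ex g w)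
    (hacyclic : ¬ ∃ (m : ℕ) (p : ℕ → V), 1 ≤ m ∧ p m = p 0 ∧
      ∀ i < m, 0 < g (p i) (p (i + 1))) :
    ∀ v, (∑ u, g u v) ≤ ∑ u ∈ S, -ex g u := by
  classical
  intro v
  let r : V → V → Prop := fun a b => 0 < g a b
  let A : Finset V := univ.filter (fun u => Relation.TransGen r u v)
  have hA : ∀ u, u ∈ A ↔ Relation.TransGen r u v := by intro u; simp [A]
  have hvA : v ∉ A := by
    rw [hA]
    intro h
    obtain ⟨m, p, hm, h0, h1, hp⟩ := path_of_transGen r h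
    exact hacyclic ⟨m, p, hm, by rw [h0, h1], hp⟩
  have hz : ∀ u b, u ∉ A → (b ∈ A ∨ b = v) → g u b = 0 := by
    intro u b hu hb
    by_contra hne
    have hpos : r u b := lt_of_le_of_ne (hg u b).1 (Ne.symm hne)
    apply hu
    rw [hA]
    rcases hb with hb | rfl
    · exact Relation.TransGen.head hpos ((hA b).1 hb)
    · exact Relation.TransGen.single hpos
  have hin : ∀ b, (b ∈ A ∨ b = v) → ∑ u, g u b = ∑ u ∈ A, g u b := by
    intro b hb
    exact (Finset.sum_subset (Finset.subset_univ A) (fun u _ hu => hz u b hu hb)).symm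
  have h1 : ∑ a ∈ A, ∑ u, g u a = ∑ a ∈ A, ∑ u ∈ A, g a u := by
    rw [Finset.sum_congr rfl (fun a ha => hin a (Or.inl ha)), Finset.sum_comm]
  have h2 : ∑ a ∈ A, (g a v + ∑ u ∈ A, g a u) ≤ ∑ a ∈ A, ∑ u, g a u := by
    apply Finset.sum_le_sum
    intro a _
    rw [← Finset.sum_insert hvA]
    exact Finset.sum_le_sum_of_subset_of_nonneg (Finset.subset_univ _) (fun u _ _ => (hg a u).1)
  rw [Finset.sum_add_distrib] at h2
  have h3 : ∑ a ∈ A, -ex g a = ∑ a ∈ A, ∑ u, g a u - ∑ a ∈ A, ∑ u, g u a := by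
    rw [← Finset.sum_sub_distrib]
    exact Finset.sum_congr rfl (fun a _ => by simp [ex])
  have h4 : ∑ a ∈ A, -ex g a ≤ ∑ a ∈ S, -ex g a := by
    rw [← Finset.sum_filter_add_sum_filter_not A (fun a => a ∈ S)]
    have h5 : ∑ a ∈ A with a ∉ S, -ex g a ≤ 0 := by
      apply Finset.sum_nonpos
      intro a ha
      have haS := (Finset.mem_filter.1 ha).2
      by_cases haT : a ∈ T
      · linarith [hT a haT]
      · rw [hcons a (by simp [haS, haT])]; simp
    have h6 : ∑ a ∈ A with a ∈ S, -ex g a ≤ ∑ a ∈ S, -ex g a := by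
      apply Finset.sum_le_sum_of_subset_of_nonneg
      · intro a ha
        exact (Finset.mem_filter.1 ha).2
      · intro a ha _
        linarith [hS a ha]
    linarith
  rw [hin v (Or.inr rfl)]
  linarith
end

section
/- Let (V,c,s,t) be a flow network and let f be a feasible flow from s to t, i.e., 0 ≤ f(u,v) ≤ c(u,v) for all u,v and ex(f,v) = 0 for every v ∉ {s,t}. If there is no residual path from s to t with respect to f, then every feasible flow f' from s to t satisfies |f'| ≤ |f|, where the value of a flow g is |g| = Σ_u g(s,u) − Σ_u g(u,s). -/
open Finset

/-- Residual capacity of the arc `(u,v)` with respect to capacities `c` and flow `f`. -/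
def cRes {V : Type*} (c f : V → V → ℝ) (u v : V) : ℝ :=
  c u v - f u v + f v u

/-- A residual path from `a` to `b` with respect to `f`. -/
def ResPath {V : Type*} (c f : V → V → ℝ) (a b : V) : Prop :=
  ∃ (m : ℕ) (p : ℕ → V), p 0 = a ∧ p m = b ∧ ∀ i < m, 0 < cRes c f (p i) (p (i + 1))

theorem resPath_step {V : Type*} (c f : V → V → ℝ) (a u v : V)
    (h : ResPath c f a u) (huv : 0 < cRes c f u v) : ResPath c f a v := by
  obtain ⟨m, p, h0, hm, hp⟩ := h
  refine ⟨m + 1, fun i => if i ≤ m then p i else v, by simp [h0], by simp, ?_⟩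
  intro i hi
  by_cases him : i < m
  · have h1 : i ≤ m := by omega
    have h2 : i + 1 ≤ m := by omega
    simpa [h1, h2] using hp i him
  · have : i = m := by omega
    subst this
    simpa [hm] using huv

theorem value_eq {V : Type*} [Fintype V] (s t : V) (χ : V → ℝ) (hs : χ s = 1) (ht : χ t = 0)
    (g : V → V → ℝ) (hg : ∀ v, v ≠ s → v ≠ t → ex g v = 0) :
    (∑ u, g s u) - (∑ u, g u s) = ∑ v, ∑ u, (χ v - χ u) * g v u := by
  have h1 : ∑ v, χ v * (-ex g v) = (∑ u, g s u) - (∑ u, g u s) := by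
    rw [Finset.sum_eq_single s]
    · simp [hs, ex]
    · intro v _ hv
      by_cases hvt : v = t
      · simp [hvt, ht]
      · simp [hg v hv hvt]
    · simp
  rw [← h1]
  have h2 : ∑ v, ∑ u, χ u * g v u = ∑ v, ∑ u, χ v * g u v := Finset.sum_comm
  simp only [sub_mul, Finset.sum_sub_distrib, h2]
  rw [← Finset.sum_sub_distrib]
  refine Finset.sum_congr rfl fun v _ => ?_
  simp only [ex, ← Finset.mul_sum]
  ring

/-- If there is no residual path from `s` to `t` with respect to a feasible flow `f`,
then `f` has maximum value among all feasible flows from `s` to `t`. -/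
theorem stmt9 {V : Type*} [Fintype V] (c : V → V → ℝ) (s t : V)
    (hst : s ≠ t)
    (hc : ∀ u v, 0 ≤ c u v)
    (f : V → V → ℝ)
    (hf : ∀ u v, 0 ≤ f u v ∧ f u v ≤ c u v)
    (hfcons : ∀ v, v ≠ s → v ≠ t → ex f v = 0)
    (hnopath : ¬ ResPath c f s t)
    (f' : V → V → ℝ)
    (hf' : ∀ u v, 0 ≤ f' u v ∧ f' u v ≤ c u v)
    (hf'cons : ∀ v, v ≠ s → v ≠ t → ex f' v = 0) :
    (∑ u, f' s u) - (∑ u, f' u s) ≤ (∑ u, f s u) - (∑ u, f u s) := by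
  classical
  have hs : ResPath c f s s := ⟨0, fun _ => s, rfl, rfl, by simp⟩
  let χ : V → ℝ := fun v => if ResPath c f s v then 1 else 0
  have hχs : χ s = 1 := by simp [χ, hs]
  have hχt : χ t = 0 := by simp [χ, hnopath]
  rw [value_eq s t χ hχs hχt f' hf'cons, value_eq s t χ hχs hχt f hfcons]
  refine Finset.sum_le_sum fun v _ => Finset.sum_le_sum fun u _ => ?_
  have key : ∀ a b, ResPath c f s a → ¬ ResPath c f s b → c a b - f a b + f b a ≤ 0 := by
    intro a b ha hb
    by_contra hlt
    exact hb (resPath_step c f s a b ha (not_le.mp hlt))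
  by_cases hv : ResPath c f s v <;> by_cases hu : ResPath c f s u <;> simp only [χ, hv, hu, if_true, if_false]
  · simp
  · have := key v u hv hu
    linarith [(hf u v).1, (hf' v u).2]
  · have := key u v hu hv
    linarith [(hf u v).2, (hf' v u).1]
  · simp
end

section
/- Let V be a finite vertex set with capacities c, let S and T be disjoint subsets of V, let g be a flow from S to T, and let F be a real number with 0 ≤ F ≤ |g|. Then there exists a flow g' from S to T with g'(u,v) ≤ g(u,v) for all u,v and |g'| = F. -/
open Finset

/-- The value of a flow from `S` to `T` can be reduced to any `F` with `0 ≤ F ≤ |g|`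
without increasing the flow on any arc. -/
theorem stmt11 {V : Type*} [Fintype V] [DecidableEq V] (c : V → V → ℝ)
    (S T : Finset V) (hST : Disjoint S T)
    (hc : ∀ u v, 0 ≤ c u v)
    (g : V → V → ℝ)
    (hg : ∀ u v, 0 ≤ g u v ∧ g u v ≤ c u v)
    (hcons : ∀ v, v ∉ S ∪ T → ex g v = 0)
    (hS : ∀ u ∈ S, ex g u ≤ 0)
    (hT : ∀ w ∈ T, 0 ≤ ex g w)
    (F : ℝ) (hF0 : 0 ≤ F) (hFle : F ≤ ∑ u ∈ S, -ex g u) :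
    ∃ g' : V → V → ℝ,
      (∀ u v, 0 ≤ g' u v ∧ g' u v ≤ c u v) ∧
      (∀ v, v ∉ S ∪ T → ex g' v = 0) ∧
      (∀ u ∈ S, ex g' u ≤ 0) ∧
      (∀ w ∈ T, 0 ≤ ex g' w) ∧
      (∀ u v, g' u v ≤ g u v) ∧
      (∑ u ∈ S, -ex g' u) = F := by
  have key : ∀ (t : ℝ) (v : V), ex (fun a b => t * g a b) v = t * ex g v := by
    intro t v
    simp only [ex, ← Finset.mul_sum, mul_sub]
  obtain ⟨t, ht0, ht1, htF⟩ : ∃ t : ℝ, 0 ≤ t ∧ t ≤ 1 ∧ t * (∑ u ∈ S, -ex g u) = F := by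
    rcases (hF0.trans hFle).eq_or_lt with h | h
    · exact ⟨0, le_rfl, zero_le_one, by rw [zero_mul]; linarith⟩
    · exact ⟨F / ∑ u ∈ S, -ex g u, div_nonneg hF0 h.le, (div_le_one h).2 hFle,
        div_mul_cancel₀ _ h.ne'⟩
  have hle : ∀ u v, t * g u v ≤ g u v := fun u v =>
    mul_le_of_le_one_left (hg u v).1 ht1
  refine ⟨fun a b => t * g a b, fun u v => ⟨mul_nonneg ht0 (hg u v).1, (hle u v).trans (hg u v).2⟩,
    fun v hv => ?_, fun u hu => ?_, fun w hw => ?_, hle, ?_⟩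
  · rw [key, hcons v hv, mul_zero]
  · rw [key]; exact mul_nonpos_of_nonneg_of_nonpos ht0 (hS u hu)
  · rw [key]; exact mul_nonneg ht0 (hT w hw)
  · rw [← htF, Finset.mul_sum]
    exact Finset.sum_congr rfl fun u _ => by rw [key, mul_neg]
end

section
/- Let (V,c,s,t) be a flow network and let A = {v ∈ V : c(s,v) > 0}. Define a new network with vertex set V' = (V ∖ {s}) ∪ {s_v : v ∈ A}, where the s_v are new vertices, and capacities c'(s_v, v) = c(s,v) for each v ∈ A, c'(x,y) = c(x,y) for all x,y ∈ V ∖ {s}, and c' = 0 on all other pairs. Then the maximum value of a feasible flow from {s} to {t} in (V,c) equals the maximum value of a flow from {s_v : v ∈ A} to {t} in (V',c'). -/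
open Finset Classical

/-- `g` is a flow from `S` to `T` with respect to capacities `c`. -/
def IsFlow {V : Type*} [Fintype V] (c : V → V → ℝ) (S T : Set V) (g : V → V → ℝ) : Prop :=
  (∀ u v, 0 ≤ g u v ∧ g u v ≤ c u v) ∧
  (∀ v, v ∉ S ∪ T → ex g v = 0) ∧
  (∀ u ∈ S, ex g u ≤ 0) ∧
  (∀ w ∈ T, 0 ≤ ex g w)

/-- The value of a flow with source set `S`: the total net outflow of the sources. -/
noncomputable def flowValue {V : Type*} [Fintype V] (S : Set V) (g : V → V → ℝ) : ℝ :=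
  ∑ u, if u ∈ S then -ex g u else 0

lemma ex_add' {V : Type*} [Fintype V] (g h : V → V → ℝ) (v : V) :
    ex (fun a b => g a b + h a b) v = ex g v + ex h v := by
  simp only [ex, Finset.sum_add_distrib]; ring

lemma ex_sub_smul {V : Type*} [Fintype V] (g h : V → V → ℝ) (e : ℝ) (v : V) :
    ex (fun a b => g a b - e * h a b) v = ex g v - e * ex h v := by
  simp only [ex, Finset.sum_sub_distrib, ← Finset.mul_sum]; ring

lemma ex_arc {V : Type*} [Fintype V] (x y v : V) :
    ex (fun a b => if a = x ∧ b = y then (1:ℝ) else 0) v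
      = (if v = y then 1 else 0) - (if v = x then 1 else 0) := by
  simp only [ex, ite_and]
  congr 1
  · simp
  · by_cases h : v = x <;> simp [h]

/-- A unit flow along a walk of positive arcs. -/
lemma walk_flow {V : Type*} [Fintype V] (g : V → V → ℝ) (s y : V)
    (hr : Relation.ReflTransGen (fun a b => 0 < g a b) s y) :
    ∃ h : V → V → ℝ, (∀ a b, 0 ≤ h a b) ∧ (∀ a b, 0 < h a b → 0 < g a b) ∧
      ∀ v, ex h v = (if v = y then 1 else 0) - (if v = s then 1 else 0) := by
  induction hr with
  | refl => exact ⟨fun _ _ => 0, by simp, by simp, by simp [ex]⟩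
  | @tail x y _ hxy ih =>
    obtain ⟨h, h0, hs, he⟩ := ih
    refine ⟨fun a b => h a b + (if a = x ∧ b = y then (1:ℝ) else 0), ?_, ?_, ?_⟩
    · intro a b
      have := h0 a b
      positivity
    · intro a b hab
      by_cases hh : a = x ∧ b = y
      · rw [hh.1, hh.2]; exact hxy
      · simp only [hh, if_false, add_zero] at hab
        exact hs a b hab
    · intro v
      rw [ex_add', he, ex_arc]; ring

lemma sum_ex {V : Type*} [Fintype V] (g : V → V → ℝ) (B : Finset V) :
    ∑ v ∈ B, ex g v = (∑ v ∈ B, ∑ u ∈ Bᶜ, g u v) - ∑ v ∈ B, ∑ u ∈ Bᶜ, g v u := by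
  have h1 : ∀ v, ex g v = (∑ u ∈ B, g u v + ∑ u ∈ Bᶜ, g u v)
      - (∑ u ∈ B, g v u + ∑ u ∈ Bᶜ, g v u) := by
    intro v
    rw [Finset.sum_add_sum_compl, Finset.sum_add_sum_compl]; rfl
  simp only [h1, Finset.sum_sub_distrib, Finset.sum_add_distrib]
  rw [Finset.sum_comm (s := B) (t := B) (f := fun v u => g u v)]
  ring

lemma reach_of_inflow {V : Type*} [Fintype V] (g : V → V → ℝ) (s x : V)
    (h0 : ∀ a b, 0 ≤ g a b) (hex : ∀ v, v ≠ s → 0 ≤ ex g v) (hx : 0 < g x s) :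
    Relation.ReflTransGen (fun a b => 0 < g a b) s x := by
  by_contra hn
  let B : Finset V := Finset.univ.filter
    (fun v => Relation.ReflTransGen (fun a b => 0 < g a b) v x)
  have hs : s ∈ Bᶜ := by simp [B, hn]
  have hxB : x ∈ B := by simp [B, Relation.ReflTransGen.refl]
  have hin : ∑ v ∈ B, ∑ u ∈ Bᶜ, g u v = 0 := by
    apply Finset.sum_eq_zero; intro v hv
    apply Finset.sum_eq_zero; intro u hu
    by_contra hne
    have hpos : 0 < g u v := lt_of_le_of_ne (h0 u v) (Ne.symm hne)
    simp only [B, Finset.mem_compl, Finset.mem_filter, Finset.mem_univ, true_and] at hv hu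
    exact hu (Relation.ReflTransGen.head hpos hv)
  have hout : g x s ≤ ∑ v ∈ B, ∑ u ∈ Bᶜ, g v u :=
    (Finset.single_le_sum (f := fun u => g x u) (fun u _ => h0 x u) hs).trans
      (Finset.single_le_sum (f := fun v => ∑ u ∈ Bᶜ, g v u)
        (fun v _ => Finset.sum_nonneg fun u _ => h0 v u) hxB)
  have hnn : 0 ≤ ∑ v ∈ B, ex g v := by
    apply Finset.sum_nonneg
    intro v hv
    apply hex
    rintro rfl
    exact (Finset.mem_compl.1 hs) hv
  rw [sum_ex, hin] at hnn
  linarith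

lemma exists_eps {V : Type*} [Fintype V] (g h : V → V → ℝ)
    (g0 : ∀ a b, 0 ≤ g a b) (h0 : ∀ a b, 0 ≤ h a b) (hs : ∀ a b, 0 < h a b → 0 < g a b) :
    ∃ e : ℝ, 0 < e ∧ ∀ a b, e * h a b ≤ g a b := by
  have key : ∀ᶠ e : ℝ in nhdsWithin 0 (Set.Ioi 0), ∀ a b, e * h a b ≤ g a b := by
    rw [Filter.eventually_all]; intro a
    rw [Filter.eventually_all]; intro b
    rcases (h0 a b).eq_or_lt with hz | hp
    · exact Filter.Eventually.of_forall fun e => by rw [← hz]; simpa using g0 a b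
    · have : Filter.Tendsto (fun e : ℝ => e * h a b) (nhdsWithin 0 (Set.Ioi 0)) (nhds (0 * h a b)) :=
        ((continuous_id.mul continuous_const).tendsto 0).mono_left nhdsWithin_le_nhds
      rw [zero_mul] at this
      filter_upwards [this.eventually (gt_mem_nhds (hs a b hp))] with e he using he.le
  obtain ⟨e, he, hpos⟩ := (key.and self_mem_nhdsWithin).exists
  exact ⟨e, hpos, he⟩

/-- Cancel all flow entering the source. -/
lemma cancel {V : Type*} [Fintype V] (g : V → V → ℝ) (s : V)
    (h0 : ∀ a b, 0 ≤ g a b) (hex : ∀ v, v ≠ s → 0 ≤ ex g v) :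
    ∃ f : V → V → ℝ, (∀ a b, 0 ≤ f a b) ∧ (∀ a b, f a b ≤ g a b) ∧
      (∀ v, ex f v = ex g v) ∧ ∀ x, f x s = 0 := by
  let K : Set (V → V → ℝ) := Set.Icc 0 g ∩ {f | ∀ v, ex f v = ex g v}
  have hK : IsCompact K := by
    apply isCompact_Icc.inter_right
    simp only [Set.ofPred_forall]
    refine isClosed_iInter fun v => isClosed_eq ?_ continuous_const
    unfold ex
    fun_prop
  have hne : K.Nonempty := ⟨g, ⟨fun a b => h0 a b, le_refl g⟩, fun _ => rfl⟩
  have hcont : ContinuousOn (fun f : V → V → ℝ => ∑ x, f x s) K := by fun_prop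
  obtain ⟨f, hfK, hmin⟩ := hK.exists_isMinOn hne hcont
  have f0 : ∀ a b, 0 ≤ f a b := fun a b => hfK.1.1 a b
  have fg : ∀ a b, f a b ≤ g a b := fun a b => hfK.1.2 a b
  refine ⟨f, f0, fg, hfK.2, ?_⟩
  intro x
  by_contra hxne
  have hx : 0 < f x s := lt_of_le_of_ne (f0 x s) (Ne.symm hxne)
  have hr := reach_of_inflow f s x f0 (fun v hv => by rw [hfK.2 v]; exact hex v hv) hx
  obtain ⟨h, hh0, hhs, hhe⟩ := walk_flow f s x hr
  let k : V → V → ℝ := fun a b => h a b + (if a = x ∧ b = s then (1:ℝ) else 0)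
  have k0 : ∀ a b, 0 ≤ k a b := fun a b => by
    have := hh0 a b
    simp only [k]; positivity
  have ks : ∀ a b, 0 < k a b → 0 < f a b := by
    intro a b hab
    by_cases hc : a = x ∧ b = s
    · rw [hc.1, hc.2]; exact hx
    · simp only [k, hc, if_false, add_zero] at hab
      exact hhs a b hab
  have ke : ∀ v, ex k v = 0 := fun v => by
    simp only [k]
    rw [ex_add', hhe, ex_arc]; ring
  obtain ⟨e, epos, he⟩ := exists_eps f k f0 k0 ks
  have hmem : (fun a b => f a b - e * k a b) ∈ K := by
    refine ⟨⟨fun a b => ?_, fun a b => ?_⟩, fun v => ?_⟩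
    · exact sub_nonneg.2 (he a b)
    · have := mul_nonneg epos.le (k0 a b)
      have := fg a b
      show f a b - e * k a b ≤ g a b
      linarith
    · rw [ex_sub_smul, ke, hfK.2 v]; ring
  have hle := hmin hmem
  simp only [Set.mem_ofPred_eq, Finset.sum_sub_distrib, ← Finset.mul_sum] at hle
  have hk1 : (1:ℝ) ≤ k x s := by
    simp only [k]; simp [hh0 x s]
  have : k x s ≤ ∑ a, k a s :=
    Finset.single_le_sum (f := fun a => k a s) (fun a _ => k0 a s) (Finset.mem_univ x)
  have : 0 < e * ∑ a, k a s := mul_pos epos (by linarith)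
  linarith

lemma ex_inl {V : Type*} [Fintype V] (g' : V ⊕ V → V ⊕ V → ℝ)
    (h1 : ∀ p u, g' p (Sum.inr u) = 0)
    (h2 : ∀ u v, u ≠ v → g' (Sum.inr u) (Sum.inl v) = 0) (v : V) :
    ex g' (Sum.inl v) = (∑ u, g' (Sum.inl u) (Sum.inl v)) + g' (Sum.inr v) (Sum.inl v)
      - ∑ u, g' (Sum.inl v) (Sum.inl u) := by
  simp only [ex, Fintype.sum_sum_type, h1, Finset.sum_const_zero, add_zero]
  rw [Fintype.sum_eq_single (f := fun u => g' (Sum.inr u) (Sum.inl v)) v (fun u hu => h2 u v hu)]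

lemma ex_inr {V : Type*} [Fintype V] (g' : V ⊕ V → V ⊕ V → ℝ)
    (h1 : ∀ p u, g' p (Sum.inr u) = 0)
    (h2 : ∀ u v, u ≠ v → g' (Sum.inr u) (Sum.inl v) = 0) (v : V) :
    ex g' (Sum.inr v) = - g' (Sum.inr v) (Sum.inl v) := by
  simp only [ex, Fintype.sum_sum_type, h1, Finset.sum_const_zero, add_zero]
  rw [Fintype.sum_eq_single (f := fun u => g' (Sum.inr v) (Sum.inl u)) v
    (fun u hu => h2 v u hu.symm)]
  ring

/-- Data transfer between a flow without inflow at `s` and a flow of the split network. -/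
lemma transfer {V : Type*} [Fintype V] (g : V → V → ℝ) (g' : V ⊕ V → V ⊕ V → ℝ) (s : V)
    (A : Set V)
    (h1 : ∀ p u, g' p (Sum.inr u) = 0)
    (h2 : ∀ u v, u ≠ v → g' (Sum.inr u) (Sum.inl v) = 0)
    (h3 : ∀ x, g x s = 0)
    (h4 : ∀ v, g' (Sum.inl s) (Sum.inl v) = 0)
    (h5 : ∀ x y, x ≠ s → g x y = g' (Sum.inl x) (Sum.inl y))
    (h6 : ∀ y, g s y = g' (Sum.inr y) (Sum.inl y))
    (h7 : ∀ y, y ∉ A → g s y = 0) :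
    (∀ v, v ≠ s → ex g' (Sum.inl v) = ex g v) ∧ ex g' (Sum.inl s) = 0 ∧
    (∀ v, ex g' (Sum.inr v) = - g s v) ∧ flowValue (Sum.inr '' A) g' = flowValue {s} g := by
  refine ⟨?_, ?_, ?_, ?_⟩
  · intro v hv
    rw [ex_inl g' h1 h2, ← h6, ex]
    congr 1
    · rw [Fintype.sum_eq_add_sum_compl s, Fintype.sum_eq_add_sum_compl s (fun u => g u v), h4,
        zero_add, add_comm]
      congr 1
      apply Finset.sum_congr rfl
      intro u hu
      rw [h5]; simpa using hu
    · exact Finset.sum_congr rfl fun u _ => (h5 v u hv).symm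
  · rw [ex_inl g' h1 h2, ← h6, h3]
    have : ∀ u, g' (Sum.inl u) (Sum.inl s) = 0 := by
      intro u
      by_cases hu : u = s
      · rw [hu, h4]
      · rw [← h5 u s hu, h3]
    simp [this, h4]
  · intro v; rw [ex_inr g' h1 h2, h6]
  · have hs : flowValue {s} g = ∑ u, g s u := by
      simp [flowValue, ex, h3]
    rw [hs, flowValue, Fintype.sum_sum_type]
    have e1 : ∀ u : V, (Sum.inl u : V ⊕ V) ∉ (Sum.inr '' A : Set (V ⊕ V)) := by simp
    have e2 : ∀ u : V, (Sum.inr u : V ⊕ V) ∈ (Sum.inr '' A : Set (V ⊕ V)) ↔ u ∈ A := by simp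
    simp only [e1, e2, if_false, Finset.sum_const_zero, zero_add]
    apply Finset.sum_congr rfl
    intro u _
    rw [ex_inr g' h1 h2, ← h6]
    split_ifs with hu
    · ring
    · rw [h7 u hu]

/-- Splitting the source `s` into one copy `s_v` per arc `(s,v)` with `c(s,v) > 0`
(the copies being modeled as the vertices `Sum.inr v`) preserves the maximum flow value. -/
theorem stmt13 {V : Type*} [Fintype V] [DecidableEq V] (c : V → V → ℝ) (s t : V)
    (hst : s ≠ t)
    (hc : ∀ u v, 0 ≤ c u v)
    (A : Set V) (hA : A = {v | 0 < c s v})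
    (c' : V ⊕ V → V ⊕ V → ℝ)
    (hc'split : ∀ v ∈ A, c' (Sum.inr v) (Sum.inl v) = c s v)
    (hc'old : ∀ x y : V, x ≠ s → y ≠ s → c' (Sum.inl x) (Sum.inl y) = c x y)
    (hc'zero : ∀ p q : V ⊕ V,
      (¬ ∃ v ∈ A, p = Sum.inr v ∧ q = Sum.inl v) →
      (¬ ∃ x y : V, x ≠ s ∧ y ≠ s ∧ p = Sum.inl x ∧ q = Sum.inl y) →
      c' p q = 0) :
    sSup {F : ℝ | ∃ g : V → V → ℝ, IsFlow c {s} {t} g ∧ flowValue {s} g = F} =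
      sSup {F : ℝ | ∃ g' : V ⊕ V → V ⊕ V → ℝ,
        IsFlow c' (Sum.inr '' A) {Sum.inl t} g' ∧ flowValue (Sum.inr '' A) g' = F} := by
  have hcA : ∀ v, v ∉ A → c s v ≤ 0 := by
    intro v hv; rw [hA] at hv; simpa using hv
  have z1 : ∀ p u, c' p (Sum.inr u) = 0 := fun p u => hc'zero _ _ (by simp) (by simp)
  have z2 : ∀ u v, u ≠ v → c' (Sum.inr u) (Sum.inl v) = 0 := fun u v huv =>
    hc'zero _ _ (by rintro ⟨w, _, h, h'⟩; simp at h h'; exact huv (h.trans h'.symm)) (by simp)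
  have z3 : ∀ v, v ∉ A → c' (Sum.inr v) (Sum.inl v) = 0 := fun v hv =>
    hc'zero _ _ (by rintro ⟨w, hw, h, h'⟩; simp at h; exact hv (h ▸ hw)) (by simp)
  have z4 : ∀ v, c' (Sum.inl s) (Sum.inl v) = 0 := fun v =>
    hc'zero _ _ (by simp) (by
      rintro ⟨x, y, hx, hy, h, h'⟩; simp at h; exact hx h.symm)
  have z5 : ∀ v, c' (Sum.inl v) (Sum.inl s) = 0 := fun v =>
    hc'zero _ _ (by simp) (by
      rintro ⟨x, y, hx, hy, h, h'⟩; simp at h'; exact hy h'.symm)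
  congr 1
  ext F
  constructor
  · rintro ⟨g, ⟨hcap, hcons, hsrc, hsink⟩, rfl⟩
    have hexn : ∀ v, v ≠ s → 0 ≤ ex g v := by
      intro v hv
      by_cases hvt : v = t
      · exact hsink v hvt
      · rw [hcons v (by simp [hv, hvt])]
    obtain ⟨f, f0, fg, fe, fs⟩ := cancel g s (fun a b => (hcap a b).1) hexn
    have fc : ∀ a b, f a b ≤ c a b := fun a b => (fg a b).trans (hcap a b).2
    have fA : ∀ y, y ∉ A → f s y = 0 := fun y hy =>
      le_antisymm ((fc s y).trans (hcA y hy)) (f0 s y)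
    let g' : V ⊕ V → V ⊕ V → ℝ := fun p q =>
      match p, q with
      | Sum.inl x, Sum.inl y => if x = s then 0 else f x y
      | Sum.inr x, Sum.inl y => if x = y then f s y else 0
      | _, Sum.inr _ => 0
    obtain ⟨t1, t2, t3, t4⟩ := transfer f g' s A
      (by intro p u; cases p <;> rfl) (by intro u v h; simp [g', h]) fs
      (by intro v; simp [g']) (by intro x y h; simp [g', h]) (by intro y; simp [g']) fA
    have hval : flowValue {s} f = flowValue {s} g := by
      unfold flowValue
      exact Finset.sum_congr rfl fun u _ => by rw [fe u]
    refine ⟨g', ⟨?_, ?_, ?_, ?_⟩, t4.trans hval⟩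
    · rintro (x | x) (y | y)
      · by_cases hx : x = s
        · simp [g', hx, z4]
        · by_cases hy : y = s
          · simp [g', hx, hy, z5, fs]
          · simp only [g', hx, if_false, hc'old x y hx hy]
            exact ⟨f0 x y, fc x y⟩
      · simp [g', z1]
      · by_cases hxy : x = y
        · subst hxy
          by_cases hxA : x ∈ A
          · simp only [g', if_true, hc'split x hxA]
            exact ⟨f0 s x, fc s x⟩
          · simp [g', z3 x hxA, fA x hxA]
        · simp [g', hxy, z2 x y hxy]
      · simp [g', z1]
    · rintro (v | v) hv
      · by_cases hvs : v = s
        · rw [hvs, t2]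
        · rw [t1 v hvs, fe]
          apply hcons
          simp at hv
          simp [hvs, hv]
      · rw [t3, fA v (by simpa using hv), neg_zero]
    · rintro _ ⟨v, hv, rfl⟩
      rw [t3]; linarith [f0 s v]
    · rintro _ rfl
      rw [t1 t hst.symm, fe]
      exact hsink t rfl
  · rintro ⟨g', ⟨hcap, hcons, hsrc, hsink⟩, rfl⟩
    have zz : ∀ p q, c' p q = 0 → g' p q = 0 := fun p q h =>
      le_antisymm ((hcap p q).2.trans h.le) (hcap p q).1
    have y1 : ∀ p u, g' p (Sum.inr u) = 0 := fun p u => zz _ _ (z1 p u)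
    have y2 : ∀ u v, u ≠ v → g' (Sum.inr u) (Sum.inl v) = 0 := fun u v h => zz _ _ (z2 u v h)
    have y4 : ∀ v, g' (Sum.inl s) (Sum.inl v) = 0 := fun v => zz _ _ (z4 v)
    have y5 : ∀ v, g' (Sum.inl v) (Sum.inl s) = 0 := fun v => zz _ _ (z5 v)
    have y6 : g' (Sum.inr s) (Sum.inl s) = 0 := by
      have h := hcons (Sum.inl s) (by simp [hst])
      rw [ex_inl g' y1 y2] at h
      simpa [y4, y5] using h
    let g : V → V → ℝ := fun x y =>
      if x = s then g' (Sum.inr y) (Sum.inl y) else g' (Sum.inl x) (Sum.inl y)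
    have gA : ∀ y, y ∉ A → g s y = 0 := by
      intro y hy
      simp [g, zz _ _ (z3 y hy)]
    have gs : ∀ x, g x s = 0 := by
      intro x
      by_cases hx : x = s <;> simp [g, hx, y5, y6]
    obtain ⟨t1, t2, t3, t4⟩ := transfer g g' s A y1 y2 gs y4
      (by intro x y h; simp [g, h]) (by intro y; simp [g]) gA
    have g0 : ∀ x y, 0 ≤ g x y := by
      intro x y
      by_cases hx : x = s
      · simp only [g, hx, if_true]; exact (hcap _ _).1
      · simp only [g, hx, if_false]; exact (hcap _ _).1
    refine ⟨g, ⟨?_, ?_, ?_, ?_⟩, t4.symm⟩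
    · intro x y
      refine ⟨g0 x y, ?_⟩
      by_cases hy : y = s
      · rw [hy, gs]; exact hc _ _
      by_cases hx : x = s
      · by_cases hyA : y ∈ A
        · rw [hx, ← hc'split y hyA]
          simp only [g, if_true]; exact (hcap _ _).2
        · rw [hx, gA y hyA]; exact hc _ _
      · rw [← hc'old x y hx hy]
        simp only [g, hx, if_false]; exact (hcap _ _).2
    · intro v hv
      have hvs : v ≠ s := fun h => hv (Or.inl h)
      have hvt : v ≠ t := fun h => hv (Or.inr h)
      rw [← t1 v hvs]
      apply hcons
      simp [hvt]
    · rintro _ rfl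
      simp only [ex, gs, Finset.sum_const_zero, zero_sub]
      exact neg_nonpos.2 (Finset.sum_nonneg fun u _ => g0 _ u)
    · rintro _ rfl
      rw [← t1 _ hst.symm]
      exact hsink _ rfl
end
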